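/- Fix p ≥ 2. For s ∈ {1,…,p−1} and S := {1,…,s}, define Υ_S(β) := ‖β_S‖_W + ‖(β_{s+1},…,β_p)‖_W for β ∈ ℝ^p, where the first wedge norm is on ℝ^p and the second is on ℝ^{p−s}. If g is a norm on ℝ^p such that ‖β‖₁ ≤ g(β) ≤ Υ_S(β) for every β ∈ ℝ^p and every s ∈ {1,…,p−1}, then g(β) = ‖β‖₁ for all β ∈ ℝ^p. -/

import Mathlib

open Finset

/-- A norm on `ℝ^p`: positive definite, absolutely homogeneous and subadditive. -/
def IsNorm {p : ℕ} (N : (Fin p → ℝ) → ℝ) : Prop :=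
  (∀ β, N β = 0 → β = 0) ∧ (∀ (c : ℝ) (β), N (c • β) = |c| * N β) ∧
    (∀ β γ, N (β + γ) ≤ N β + N γ)

/-- The wedge norm on `ℝ^k`:
`‖v‖_W = inf { (1/2)·Σ_j (v_j²/a_j + a_j) : a₁ ≥ a₂ ≥ … ≥ a_k > 0 }`. -/
noncomputable def wedge (k : ℕ) (v : Fin k → ℝ) : ℝ :=
  sInf ((fun a : Fin k → ℝ => (1 / 2) * ∑ j, (v j ^ 2 / a j + a j)) ''
    {a | (∀ j, 0 < a j) ∧ ∀ j j' : Fin k, j ≤ j' → a j' ≤ a j})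

/-- A nonincreasing nonnegative vector has wedge norm at most the sum of its entries. -/
theorem wedge_le_sum {k : ℕ} {v : Fin k → ℝ} (hv : ∀ j, 0 ≤ v j) (hanti : Antitone v) :
    wedge k v ≤ ∑ j, v j := by
  have hbdd : BddBelow ((fun a : Fin k → ℝ => (1 / 2) * ∑ j, (v j ^ 2 / a j + a j)) ''
      {a | (∀ j, 0 < a j) ∧ ∀ j j' : Fin k, j ≤ j' → a j' ≤ a j}) := by
    refine ⟨0, ?_⟩
    rintro _ ⟨a, ⟨ha, -⟩, rfl⟩
    exact mul_nonneg (by norm_num) (sum_nonneg fun j _ => by have := ha j; positivity)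
  have key : ∀ ε : ℝ, 0 < ε → wedge k v ≤ ∑ j, v j + (k / 2) * ε := by
    intro ε hε
    have hpos : ∀ j, 0 < v j + ε := fun j => add_pos_of_nonneg_of_pos (hv j) hε
    refine (csInf_le hbdd ⟨fun j => v j + ε,
      ⟨hpos, fun j j' h => by have := hanti h; simpa using this⟩, rfl⟩).trans ?_
    have hterm : ∑ j, (v j ^ 2 / (v j + ε) + (v j + ε)) ≤ ∑ j, (2 * v j + ε) := by
      refine sum_le_sum fun j _ => ?_
      have : v j ^ 2 / (v j + ε) ≤ v j := by
        rw [div_le_iff₀ (hpos j)]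
        nlinarith [mul_nonneg (hv j) hε.le]
      linarith
    rw [sum_add_distrib (f := fun j => 2 * v j), ← mul_sum, sum_const, card_univ,
      Fintype.card_fin, nsmul_eq_mul] at hterm
    change 1 / 2 * ∑ j, (v j ^ 2 / (v j + ε) + (v j + ε)) ≤ _
    linarith
  refine le_of_forall_pos_le_add fun δ hδ => ?_
  refine (key (δ / (k + 1)) (by positivity)).trans ?_
  gcongr
  rw [div_mul_div_comm, div_le_iff₀ (by positivity)]
  nlinarith [(Nat.cast_nonneg k : (0 : ℝ) ≤ k)]

theorem wedge_zero_le (k : ℕ) : wedge k (fun _ => 0) ≤ 0 := by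
  simpa using wedge_le_sum (v := fun _ : Fin k => (0 : ℝ)) (fun _ => le_rfl) antitone_const

/-- The first standard basis vector has wedge norm at most one. -/
theorem wedge_first_le_one (k : ℕ) :
    wedge k (fun j => if (j : ℕ) = 0 then 1 else 0) ≤ 1 := by
  refine (wedge_le_sum (fun j => by split_ifs <;> norm_num) ?_).trans ?_
  · intro i j hij
    have : (i : ℕ) ≤ j := hij
    dsimp only
    split_ifs <;> first | omega | norm_num
  · cases k with
    | zero => simp
    | succ n => simp

/-- A norm is bounded by the `ℓ₁`-norm once it is at most one on the standard basis. -/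
theorem IsNorm.le_l1 {p : ℕ} {g : (Fin p → ℝ) → ℝ} (hg : IsNorm g)
    (hbasis : ∀ i, g (Pi.single i 1) ≤ 1) (β : Fin p → ℝ) : g β ≤ ∑ i, |β i| := by
  obtain ⟨-, hsmul, hadd⟩ := hg
  have hzero : g 0 = 0 := by simpa using hsmul 0 0
  calc g β = g (∑ i, β i • Pi.single i (1 : ℝ)) := by
        congr 1
        ext j
        simp [Finset.sum_apply, Pi.single_apply]
    _ ≤ ∑ i, g (β i • Pi.single i (1 : ℝ)) := le_sum_of_subadditive g hzero.le hadd _ _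
    _ ≤ ∑ i, |β i| := sum_le_sum fun i _ => by
        rw [hsmul]
        exact mul_le_of_le_one_right (abs_nonneg _) (hbasis i)

/-- If a norm `g` on `ℝ^p` satisfies `‖β‖₁ ≤ g(β) ≤ Υ_S(β)` for every `β` and every
`S = {1,…,s}` with `1 ≤ s ≤ p−1`, where `Υ_S(β) = ‖β_S‖_W + ‖(β_{s+1},…,β_p)‖_W`,
then `g` is the `ℓ₁`-norm. -/
theorem stmt13 {p : ℕ} (hp : 2 ≤ p) (g : (Fin p → ℝ) → ℝ) (hg : IsNorm g)
    (hlow : ∀ β : Fin p → ℝ, ∑ i, |β i| ≤ g β)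
    (hup : ∀ s : ℕ, 1 ≤ s → s ≤ p - 1 → ∀ β : Fin p → ℝ,
      g β ≤ wedge p (fun i => if (i : ℕ) < s then β i else 0) +
        wedge (p - s) (fun i => β ⟨s + (i : ℕ), by have := i.isLt; omega⟩)) :
    ∀ β : Fin p → ℝ, g β = ∑ i, |β i| := by
  refine fun β => le_antisymm (hg.le_l1 (fun i => ?_) β) (hlow β)
  have hi := i.isLt
  rcases Nat.eq_zero_or_pos (i : ℕ) with h0 | hpos
  · refine (hup 1 le_rfl (by omega) (Pi.single i 1)).trans ?_
    have h1 : (fun j : Fin p => if (j : ℕ) < 1 then (Pi.single i 1 : Fin p → ℝ) j else 0)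
        = fun j : Fin p => if (j : ℕ) = 0 then (1 : ℝ) else 0 := by
      funext j
      simp only [Pi.single_apply, Fin.ext_iff]
      split_ifs <;> first | rfl | omega
    have h2 : (fun j : Fin (p - 1) => (Pi.single i 1 : Fin p → ℝ)
        ⟨1 + (j : ℕ), by have := j.isLt; omega⟩) = fun _ => 0 := by
      funext j
      simp only [Pi.single_apply, Fin.ext_iff]
      split_ifs <;> first | rfl | omega
    rw [h1, h2]
    linarith [wedge_first_le_one p, wedge_zero_le (p - 1)]
  · refine (hup i hpos (by omega) (Pi.single i 1)).trans ?_
    have h1 : (fun j : Fin p => if (j : ℕ) < i then (Pi.single i 1 : Fin p → ℝ) j else 0)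
        = fun _ => 0 := by
      funext j
      simp only [Pi.single_apply, Fin.ext_iff]
      split_ifs <;> first | rfl | omega
    have h2 : (fun j : Fin (p - i) => (Pi.single i 1 : Fin p → ℝ)
        ⟨i + (j : ℕ), by have := j.isLt; omega⟩) =
        fun j : Fin (p - i) => if (j : ℕ) = 0 then (1 : ℝ) else 0 := by
      funext j
      simp only [Pi.single_apply, Fin.ext_iff]
      split_ifs <;> first | rfl | omega
    rw [h1, h2]
    linarith [wedge_first_le_one (p - i), wedge_zero_le p]
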